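/- Let G be a finite undirected simple graph with no isolated vertices and let K_k denote the complete simple graph on k vertices. Then h(G) + k − 1 ≤ h(G ∇ K_k) ≤ h(G) + k, where G ∇ K_k is the join of G and K_k. -/

import Mathlib

/-- `nbhd adj A` is the set of vertices having at least one neighbor in `A`
(for the symmetric adjacency relation `adj`, which may have loops). -/
def nbhd {V : Type*} (adj : V → V → Prop) (A : Set V) : Set V :=
  {v | ∃ u ∈ A, adj u v}

/-- Rabbit territory at (0-indexed) time `t` against the hunter strategy `W`,
when the rabbit may start anywhere in `S`.  (`terr adj S W (t-1)` is the set `R_t`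
of the paper: `R_1 = S \ W_1`, `R_t = N(R_{t-1}) \ W_t`.) -/
def terr {V : Type*} (adj : V → V → Prop) (S : Set V) (W : ℕ → Set V) : ℕ → Set V
  | 0 => S \ W 0
  | t + 1 => nbhd adj (terr adj S W t) \ W (t + 1)

/-- The hunter strategy `W` uses at most `k` hunters. -/
def UsesAtMost {V : Type*} (W : ℕ → Set V) (k : ℕ) : Prop :=
  ∀ t, (W t).ncard ≤ k

/-- The hunting number when the rabbit is restricted to start in `S`:
the least `k` for which some strategy using `k` hunters empties the territory. -/
noncomputable def huntingNumberFrom {V : Type*} (adj : V → V → Prop) (S : Set V) : ℕ :=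
  sInf {k | ∃ W : ℕ → Set V, UsesAtMost W k ∧ ∃ T, terr adj S W T = ∅}

/-- The hunting number `h(G)`. -/
noncomputable def huntingNumber {V : Type*} (adj : V → V → Prop) : ℕ :=
  huntingNumberFrom adj Set.univ

/-- The hunting number with time limit `l ≥ 1`, `h(G,l)`:
the strategy `W_1, …, W_l` corresponds to indices `0, …, l-1`, and the rabbit must be
caught by round `l`, i.e. `R_l = terr … (l-1) = ∅`. -/
noncomputable def huntingNumberTL {V : Type*} (adj : V → V → Prop) (l : ℕ) : ℕ :=
  sInf {k | ∃ W : ℕ → Set V, UsesAtMost W k ∧ terr adj Set.univ W (l - 1) = ∅}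

/-- The join `G ∇ H` of two graphs: disjoint union plus all edges between the two sides. -/
def adjJoin {V U : Type*} (adjG : V → V → Prop) (adjH : U → U → Prop) :
    V ⊕ U → V ⊕ U → Prop
  | Sum.inl a, Sum.inl b => adjG a b
  | Sum.inr a, Sum.inr b => adjH a b
  | Sum.inl _, Sum.inr _ => True
  | Sum.inr _, Sum.inl _ => True

theorem terr_congr {V : Type*} (adj : V → V → Prop) (S : Set V) {W W' : ℕ → Set V} {n : ℕ}
    (h : ∀ i ≤ n, W i = W' i) : terr adj S W n = terr adj S W' n := by
  induction n with
  | zero => simp only [terr, h 0 le_rfl]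
  | succ n ih =>
    simp only [terr, h (n + 1) le_rfl, ih fun i hi => h i (hi.trans n.le_succ)]

theorem exists_terr_eq_empty_of_huntingNumber {V : Type*} [Finite V] (adj : V → V → Prop) :
    ∃ W : ℕ → Set V, UsesAtMost W (huntingNumber adj) ∧ ∃ T, terr adj Set.univ W T = ∅ :=
  Nat.sInf_mem (s := {k | ∃ W : ℕ → Set V, UsesAtMost W k ∧ ∃ T, terr adj Set.univ W T = ∅})
    ⟨Nat.card V, fun _ => Set.univ, fun _ => (Set.ncard_univ V).le, 0, by simp [terr]⟩

theorem huntingNumber_le {V : Type*} {adj : V → V → Prop} {W : ℕ → Set V} {k T : ℕ}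
    (hW : UsesAtMost W k) (hT : terr adj Set.univ W T = ∅) : huntingNumber adj ≤ k :=
  Nat.sInf_le ⟨W, hW, T, hT⟩

theorem ncard_preimage_inl_add_ncard_preimage_inr {V U : Type*} [Finite V] [Finite U]
    (A : Set (V ⊕ U)) :
    (Sum.inl ⁻¹' A : Set V).ncard + (Sum.inr ⁻¹' A : Set U).ncard = A.ncard := by
  rw [← Set.ncard_image_of_injective _ (Sum.inl_injective (α := V) (β := U)),
    ← Set.ncard_image_of_injective _ (Sum.inr_injective (α := V) (β := U)),
    ← Set.ncard_union_eq, Set.image_preimage_inl_union_image_preimage_inr]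
  exact Set.disjoint_image_inl_image_inr.mono le_rfl le_rfl

/-- `A` is the territory after finitely many rounds of a strategy using fewer than `m` hunters. -/
def IsTerritory {V : Type*} (adj : V → V → Prop) (m : ℕ) (A : Set V) : Prop :=
  ∃ W : ℕ → Set V, (∀ t, (W t).ncard < m) ∧ ∃ n, terr adj Set.univ W n = A

theorem IsTerritory.compl {V : Type*} (adj : V → V → Prop) {m : ℕ} {X : Set V}
    (hX : X.ncard < m) : IsTerritory adj m Xᶜ :=
  ⟨fun _ => X, fun _ => hX, 0, by simp [terr, Set.compl_eq_univ_sdiff]⟩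

theorem IsTerritory.nbhd_diff {V : Type*} {adj : V → V → Prop} {m : ℕ} {A X : Set V}
    (hA : IsTerritory adj m A) (hX : X.ncard < m) : IsTerritory adj m (nbhd adj A \ X) := by
  obtain ⟨W, hW, n, rfl⟩ := hA
  refine ⟨fun i => if i ≤ n then W i else X, fun t => ?_, n + 1, ?_⟩
  · dsimp only
    split_ifs
    exacts [hW t, hX]
  · rw [terr, terr_congr adj Set.univ (W' := W) fun i hi => if_pos hi, if_neg (by omega)]

theorem IsTerritory.nonempty {V : Type*} {adj : V → V → Prop} {A : Set V}
    (hA : IsTerritory adj (huntingNumber adj) A) : A.Nonempty := by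
  obtain ⟨W, hW, n, rfl⟩ := hA
  by_contra hne
  have h := huntingNumber_le (k := huntingNumber adj - 1)
    (fun t => Nat.le_sub_one_of_lt (hW t)) (Set.not_nonempty_iff_eq_empty.mp hne)
  have := hW 0
  omega

theorem huntingNumber_adjJoin_le {V U : Type*} [Finite V] [Finite U] (adjG : V → V → Prop)
    (adjH : U → U → Prop) :
    huntingNumber (adjJoin adjG adjH) ≤ huntingNumber adjG + Nat.card U := by
  obtain ⟨W, hW, T, hT⟩ := exists_terr_eq_empty_of_huntingNumber adjG
  have key : ∀ t, terr (adjJoin adjG adjH) Set.univ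
      (fun t => Sum.inl '' W t ∪ Set.range Sum.inr) t ⊆
        Sum.inl '' terr adjG Set.univ W t := by
    intro t
    induction t with
    | zero => rintro (v | u) <;> simp [terr]
    | succ t ih =>
      rintro (v | u) hx
      · obtain ⟨⟨y, hy, hyv⟩, hv⟩ := hx
        obtain ⟨w, hw, rfl⟩ := ih hy
        exact ⟨v, ⟨⟨w, hw, hyv⟩, fun h => hv (Or.inl ⟨v, h, rfl⟩)⟩, rfl⟩
      · exact absurd (Or.inr ⟨u, rfl⟩) hx.2
  refine huntingNumber_le (W := fun t => Sum.inl '' W t ∪ Set.range Sum.inr) (T := T)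
    (fun t => ?_) (Set.subset_empty_iff.mp ?_)
  · refine (Set.ncard_union_le _ _).trans (Nat.add_le_add ?_ ?_)
    · exact (Set.ncard_image_le (Set.toFinite _)).trans (hW t)
    · rw [← Set.image_univ, ← Set.ncard_univ U]
      exact Set.ncard_image_le (Set.toFinite _)
  · simpa [hT] using key T

theorem huntingNumber_add_card_le_adjJoin_ne {V U : Type*} [Finite V] [Finite U]
    (adj : V → V → Prop) :
    huntingNumber adj + Nat.card U ≤
      huntingNumber (adjJoin adj (fun i j : U => i ≠ j)) + 1 := by
  obtain ⟨W, hW, T, hT⟩ :=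
    exists_terr_eq_empty_of_huntingNumber (adjJoin adj (fun i j : U => i ≠ j))
  by_contra! hlt
  set R := terr (adjJoin adj (fun i j : U => i ≠ j)) Set.univ W with hR
  have hcard := fun t => (ncard_preimage_inl_add_ncard_preimage_inr (W t)).trans_le (hW t)
  have hcover : ∀ t, (∀ u, Sum.inr u ∈ W t) →
      (Sum.inl ⁻¹' W t : Set V).ncard < huntingNumber adj := by
    intro t ht
    have huniv : (Sum.inr ⁻¹' W t : Set U) = Set.univ := Set.eq_univ_of_forall ht
    have := hcard t
    rw [huniv, Set.ncard_univ] at this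
    omega
  have hcover' : ∀ t c, (∀ u, c ≠ u → Sum.inr u ∈ W t) →
      (Sum.inl ⁻¹' W t : Set V).ncard < huntingNumber adj := by
    intro t c ht
    have huniv : insert c (Sum.inr ⁻¹' W t : Set U) = Set.univ :=
      Set.eq_univ_of_forall fun u => or_iff_not_imp_left.mpr fun h => ht u (Ne.symm h)
    have h₁ := Set.ncard_insert_le c (Sum.inr ⁻¹' W t : Set U)
    rw [huniv, Set.ncard_univ] at h₁
    have := hcard t
    omega
  have key : ∀ t, (∃ u, Sum.inr u ∈ R t) ∨
      ∃ A, IsTerritory adj (huntingNumber adj) A ∧ A ⊆ Sum.inl ⁻¹' R t := by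
    intro t
    refine or_iff_not_imp_left.mpr fun hnone => ?_
    push Not at hnone
    induction t with
    | zero =>
      have h₀ : ∀ u, Sum.inr u ∈ W 0 := fun u => by simpa [hR, terr] using hnone u
      exact ⟨_, .compl adj (hcover 0 h₀), fun v hv => ⟨trivial, hv⟩⟩
    | succ t ih =>
      have hmem : ∀ u, Sum.inr u ∈ nbhd (adjJoin adj (fun i j : U => i ≠ j)) (R t) →
          Sum.inr u ∈ W (t + 1) := fun u hu => by_contra fun h => hnone u ⟨hu, h⟩
      by_cases hc : ∃ c, Sum.inr c ∈ R t
      · obtain ⟨c, hc⟩ := hc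
        exact ⟨_, .compl adj (hcover' (t + 1) c fun u hu => hmem u ⟨_, hc, hu⟩),
          fun v hv => ⟨⟨_, hc, trivial⟩, hv⟩⟩
      · obtain ⟨A, hA, hAR⟩ := ih (by simpa using hc)
        obtain ⟨a, ha⟩ := hA.nonempty
        refine ⟨_, hA.nbhd_diff (hcover (t + 1) fun u => hmem u ⟨_, hAR ha, trivial⟩), ?_⟩
        rintro v ⟨⟨w, hw, hwv⟩, hv⟩
        exact ⟨⟨_, hAR hw, hwv⟩, hv⟩
  rcases key T with ⟨u, hu⟩ | ⟨A, hA, hAR⟩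
  · simp [hT] at hu
  · obtain ⟨a, ha⟩ := hA.nonempty
    simpa [hT] using hAR ha

/-- for a simple graph `G` and the complete simple graph `K_k`
(adjacency on `Fin k`: `i ≠ j`), `h(G) + k − 1 ≤ h(G ∇ K_k) ≤ h(G) + k`. -/
theorem hunting_number_join_complete {V : Type*} [Fintype V]
    (G : SimpleGraph V) (hniso : ∀ v, ∃ u, G.Adj v u) (k : ℕ) :
    huntingNumber G.Adj + k - 1 ≤
        huntingNumber (adjJoin G.Adj (fun i j : Fin k => i ≠ j)) ∧
    huntingNumber (adjJoin G.Adj (fun i j : Fin k => i ≠ j)) ≤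
        huntingNumber G.Adj + k := by
  have hlower := huntingNumber_add_card_le_adjJoin_ne (U := Fin k) G.Adj
  have hupper := huntingNumber_adjJoin_le G.Adj (fun i j : Fin k => i ≠ j)
  rw [Nat.card_fin] at hlower hupper
  exact ⟨Nat.sub_le_of_le_add hlower, hupper⟩
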